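/- Base case of Lemma 2. Let ψ : ℝ → ℝ² be a continuous 1-periodic loop injective on [0,1), D = Inside(ψ), P ⊂ D a finite set, and Ω = (D ∪ range ψ) \ P. Let f be a minimal generic curve in Ω with exactly one double point, whose two preimages are a < b in (0,1), such that f(0) ∈ range ψ, neither f(0) nor f(1) is the double point, and the loop f|[a,b] is freely homotopic to ψ through loops with values in Ω. Then f(1) ∉ Inside(f|[a,b]), i.e., the terminal point of f lies outside the simple loop f|[a,b]. -/

import Mathlib

open Set Function

noncomputable section

/-- The plane `ℝ²`. -/
abbrev Plane : Type := ℝ × ℝ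

/-- `φ` is a (continuous, 1-periodic) loop with values in `S`. -/
def IsLoopIn (S : Set Plane) (φ : ℝ → Plane) : Prop :=
  Continuous φ ∧ Periodic φ 1 ∧ range φ ⊆ S

/-- `φ` and `ψ` are freely homotopic through loops with values in `S`,
i.e. homotopic as continuous maps `ℝ/ℤ → S`. -/
def FreelyHomotopicIn (S : Set Plane) (φ ψ : ℝ → Plane) : Prop :=
  ∃ H : ℝ → ℝ → Plane, Continuous (uncurry H) ∧
    (∀ s ∈ Icc (0:ℝ) 1, Periodic (H s) 1 ∧ range (H s) ⊆ S) ∧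
    H 0 = φ ∧ H 1 = ψ

/-- `φ` is null-homotopic in `S`: freely homotopic in `S` to a constant loop. -/
def NullHomotopicIn (S : Set Plane) (φ : ℝ → Plane) : Prop :=
  ∃ c : Plane, FreelyHomotopicIn S φ (fun _ => c)

/-- The determinant of the `2 × 2` matrix with columns `v`, `w`. -/
def crossDet (v w : Plane) : ℝ := v.1 * w.2 - v.2 * w.1

/-- The set of double points of a 1-periodic loop `φ`: points with (at least)
two preimages in `[0,1)`. -/
def doublePoints (φ : ℝ → Plane) : Set Plane :=
  {p | ∃ x ∈ Ico (0:ℝ) 1, ∃ y ∈ Ico (0:ℝ) 1, x ≠ y ∧ φ x = p ∧ φ y = p}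

/-- A generic loop in `S`: a `C¹` 1-periodic map `ℝ → ℝ²` with range in `S` and
nowhere-vanishing derivative, such that only finitely many points have more than one
preimage in `[0,1)`, there are no triple points, and at each double point the two
velocity vectors are linearly independent (so each such point has exactly two
preimages in `[0,1)`, transversal). -/
def GenericLoop (S : Set Plane) (φ : ℝ → Plane) : Prop :=
  ContDiff ℝ 1 φ ∧ Periodic φ 1 ∧ range φ ⊆ S ∧ (∀ t : ℝ, deriv φ t ≠ 0) ∧
  {t ∈ Ico (0:ℝ) 1 | ∃ s ∈ Ico (0:ℝ) 1, s ≠ t ∧ φ s = φ t}.Finite ∧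
  (∀ x ∈ Ico (0:ℝ) 1, ∀ y ∈ Ico (0:ℝ) 1, ∀ z ∈ Ico (0:ℝ) 1,
    x ≠ y → y ≠ z → x ≠ z → φ x = φ y → φ y ≠ φ z) ∧
  (∀ x ∈ Ico (0:ℝ) 1, ∀ y ∈ Ico (0:ℝ) 1, x ≠ y → φ x = φ y →
    LinearIndependent ℝ ![deriv φ x, deriv φ y])

/-- A generic loop `φ` in `S` is minimal if every generic loop in `S` freely homotopic
to `φ` in `S` whose range is contained in the range of `φ` has at least as many
double points as `φ`. -/
def MinimalLoop (S : Set Plane) (φ : ℝ → Plane) : Prop :=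
  GenericLoop S φ ∧ ∀ g : ℝ → Plane, GenericLoop S g → FreelyHomotopicIn S g φ →
    range g ⊆ range φ → (doublePoints φ).ncard ≤ (doublePoints g).ncard

/-- Length of the positive parameter interval from `x` to `y` (mod 1). -/
def segLen (x y : ℝ) : ℝ := if x < y then y - x else y + 1 - x

/-- The loop `φ_{xy}` based at `φ x = φ y`, traversing `φ` from parameter `x` to
parameter `y` in the positive direction, reparametrized as a 1-periodic loop. -/
def loopSeg (φ : ℝ → Plane) (x y : ℝ) : ℝ → Plane :=
  fun t => φ (x + segLen x y * Int.fract t)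

/-- `sign (x, y)`: the sign of the determinant of the matrix whose columns are the
velocity vectors `φ' x` and `φ' y`. -/
def signXY (φ : ℝ → Plane) (x y : ℝ) : ℤ :=
  if 0 < crossDet (deriv φ x) (deriv φ y) then 1 else -1

/-- The `n`-th power of a 1-periodic loop: `t ↦ ψ (n * t)`. -/
def loopPow (ψ : ℝ → Plane) (n : ℕ) : ℝ → Plane := fun t => ψ (n * t)

/-- A 1-periodic loop is simple if it is injective on `[0, 1)`. -/
def IsSimpleLoop (ψ : ℝ → Plane) : Prop := InjOn ψ (Ico 0 1)

/-- `Inside γ`: the union of the bounded connected components of the complement of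
the range of `γ`. -/
def Inside (γ : ℝ → Plane) : Set Plane :=
  {p | p ∉ range γ ∧ Bornology.IsBounded (connectedComponentIn (range γ)ᶜ p)}

/-- Two paths `f g : [0,1] → ℝ²` with the same endpoints are path-homotopic in `S`
if they are homotopic relative to their endpoints through maps with values in `S`. -/
def PathHomotopicIn (S : Set Plane) (f g : ℝ → Plane) : Prop :=
  f 0 = g 0 ∧ f 1 = g 1 ∧
  ∃ H : ℝ → ℝ → Plane, ContinuousOn (uncurry H) (Icc 0 1 ×ˢ Icc 0 1) ∧
    (∀ s ∈ Icc (0:ℝ) 1, ∀ t ∈ Icc (0:ℝ) 1, H s t ∈ S) ∧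
    (∀ t ∈ Icc (0:ℝ) 1, H 0 t = f t ∧ H 1 t = g t) ∧
    (∀ s ∈ Icc (0:ℝ) 1, H s 0 = f 0 ∧ H s 1 = f 1)

/-- The restriction `f|[a,b]`, affinely reparametrized over `[0,1]`, as a path from
`f a` to `f b`.  (`subPath f b a` is the reverse of `subPath f a b`.) -/
def subPath (f : ℝ → Plane) (a b : ℝ) : ℝ → Plane := fun t => f (a + t * (b - a))

/-- Concatenation of two paths (traversing `p` first, then `q`). -/
def concatPath (p q : ℝ → Plane) : ℝ → Plane :=
  fun t => if t ≤ 1 / 2 then p (2 * t) else q (2 * t - 1)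

/-- The set of double points of a curve `f : [0,1] → ℝ²`: points with (at least) two
preimages, these lying in the open interval `(0,1)`. -/
def doublePointsCurve (f : ℝ → Plane) : Set Plane :=
  {p | ∃ x ∈ Ioo (0:ℝ) 1, ∃ y ∈ Ioo (0:ℝ) 1, x ≠ y ∧ f x = p ∧ f y = p}

/-- A generic curve in `S`: a `C¹` map `f : [0,1] → ℝ²` with values in `S` and
nowhere-vanishing derivative, such that only finitely many points have more than one
preimage, there are no triple points, and every double point (other than a possible
coincidence of the two endpoints) has its two preimages in `(0,1)` with linearly
independent velocity vectors. -/
def GenericCurve (S : Set Plane) (f : ℝ → Plane) : Prop :=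
  ContDiffOn ℝ 1 f (Icc 0 1) ∧ f '' Icc 0 1 ⊆ S ∧
  (∀ t ∈ Icc (0:ℝ) 1, derivWithin f (Icc 0 1) t ≠ 0) ∧
  {t ∈ Icc (0:ℝ) 1 | ∃ s ∈ Icc (0:ℝ) 1, s ≠ t ∧ f s = f t}.Finite ∧
  (∀ x ∈ Icc (0:ℝ) 1, ∀ y ∈ Icc (0:ℝ) 1, x ≠ y → f x = f y →
    ¬((x = 0 ∧ y = 1) ∨ (x = 1 ∧ y = 0)) →
    x ∈ Ioo (0:ℝ) 1 ∧ y ∈ Ioo (0:ℝ) 1 ∧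
    LinearIndependent ℝ ![derivWithin f (Icc 0 1) x, derivWithin f (Icc 0 1) y]) ∧
  (∀ x ∈ Icc (0:ℝ) 1, ∀ y ∈ Icc (0:ℝ) 1, ∀ z ∈ Icc (0:ℝ) 1,
    x ≠ y → y ≠ z → x ≠ z → f x = f y → f y ≠ f z)

/-- A generic curve `f` in `S` is minimal if every generic curve in `S` with the same
endpoints, homotopic to `f` rel endpoints in `S`, and with range contained in the range
of `f`, has at least as many double points as `f`. -/
def MinimalCurve (S : Set Plane) (f : ℝ → Plane) : Prop :=
  GenericCurve S f ∧ ∀ g : ℝ → Plane, GenericCurve S g →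
    PathHomotopicIn S g f → g '' Icc 0 1 ⊆ f '' Icc 0 1 →
    (doublePointsCurve f).ncard ≤ (doublePointsCurve g).ncard

/-- The restriction `f|[a,b]` with `f a = f b`, regarded (after reparametrization)
as a 1-periodic loop based at `f a`. -/
def subLoop (f : ℝ → Plane) (a b : ℝ) : ℝ → Plane :=
  fun t => f (a + (b - a) * Int.fract t)

theorem exists_continuous_log {X : Type*} [TopologicalSpace X] [SimplyConnectedSpace X]
    [LocallyPathConnectedSpace X] (g : C(X, ℂ)) (hg : ∀ x, g x ≠ 0) :
    ∃ G : C(X, ℂ), ∀ x, Complex.exp (G x) = g x := by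
  obtain ⟨x₀⟩ : Nonempty X := inferInstance
  obtain ⟨G, ⟨-, hG⟩, -⟩ := Complex.isCoveringMapOn_exp.existsUnique_continuousMap_lifts g
    (Complex.exp_log (hg x₀)) (fun x => hg x)
  exact ⟨G, fun x => congrFun hG x⟩

/-- The identity of a circle centred at the origin has no continuous logarithm. -/
theorem not_exists_log_circle {G : ℝ → ℂ} (hG : Continuous G) {R : ℝ}
    (h : ∀ θ : ℝ, Complex.exp (G θ) = R * Complex.exp (θ * Complex.I)) :
    G (2 * Real.pi) ≠ G 0 := by
  intro hper
  have hcont : Continuous fun θ : ℝ => G θ - θ * Complex.I := by fun_prop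
  have hexp : ∀ θ : ℝ, Complex.exp (G θ - θ * Complex.I) = R := fun θ => by
    rw [Complex.exp_sub, h, mul_div_cancel_right₀ _ (Complex.exp_ne_zero _)]
  have hconst := Complex.isCoveringMap_exp.const_of_comp hcont
    (fun s t => Subtype.ext ((hexp s).trans (hexp t).symm)) (2 * Real.pi) 0
  simp only [hper, Complex.ofReal_zero, zero_mul, sub_zero, sub_eq_self] at hconst
  simp [Real.pi_ne_zero] at hconst

theorem frontier_connectedComponentIn_subset {X : Type*} [TopologicalSpace X]
    [LocallyConnectedSpace X] {F : Set X} (hF : IsOpen F) (x : X) :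
    frontier (connectedComponentIn F x) ⊆ Fᶜ := by
  intro z hz hzF
  have hopen : IsOpen (connectedComponentIn F x) := hF.connectedComponentIn
  rw [hopen.frontier_eq] at hz
  obtain ⟨y, hy, hyx⟩ := mem_closure_iff.1 hz.1 _ hF.connectedComponentIn
    (mem_connectedComponentIn hzF)
  apply hz.2
  rw [connectedComponentIn_eq hyx, ← connectedComponentIn_eq hy]
  exact mem_connectedComponentIn hzF

/-- Borsuk's criterion, one direction: if `z ↦ z - p` has a continuous logarithm on the closed set
`A`, then `p` lies in an unbounded component of the complement of `A`. -/
theorem not_isBounded_connectedComponentIn_of_log {A : Set Plane} (hA : IsClosed A) {p : Plane}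
    (hp : p ∉ A) (G : C(Plane, ℂ))
    (hG : ∀ z ∈ A, Complex.exp (G z) = Complex.equivRealProdCLM.symm (z - p)) :
    ¬ Bornology.IsBounded (connectedComponentIn Aᶜ p) := by
  classical
  intro hb
  set C := connectedComponentIn Aᶜ p with hC
  set e := Complex.equivRealProdCLM.symm
  have hpC : p ∈ C := mem_connectedComponentIn hp
  let F : Plane → ℂ := C.piecewise (fun z => Complex.exp (G z)) (fun z => e (z - p))
  have hF : Continuous F := by
    apply Continuous.piecewise
    · intro z hz
      exact hG z (not_not.1 (frontier_connectedComponentIn_subset hA.isOpen_compl p hz))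
    · fun_prop
    · fun_prop
  have hF0 : ∀ z, F z ≠ 0 := fun z => by
    by_cases hz : z ∈ C
    · simp [F, hz, Complex.exp_ne_zero]
    · have : z - p ≠ 0 := fun h => hz (by rwa [sub_eq_zero.1 h])
      simpa only [F, piecewise_eq_of_notMem _ _ _ hz] using e.map_eq_zero_iff.not.2 this
  obtain ⟨L, hL⟩ := exists_continuous_log ⟨F, hF⟩ hF0
  have hb' : Bornology.IsBounded ((fun z => e (z - p)) '' C) := by
    have : (fun z => e (z - p)) '' C = e '' ((fun z => z + (-p)) '' C) := by
      rw [image_image]; simp [sub_eq_add_neg]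
    rw [this]
    refine e.lipschitz.isBounded_image ?_
    exact (LipschitzWith.of_dist_le_mul (K := 1) (by simp)).isBounded_image hb
  obtain ⟨R, hR⟩ := hb'.subset_ball 0
  have hRpos : 0 < R := by
    have := hR (mem_image_of_mem _ hpC)
    simpa using this
  let c : ℝ → Plane := fun θ => e.symm (R * Complex.exp (θ * Complex.I)) + p
  have hc : Continuous c := by
    have : Continuous fun θ : ℝ => (R : ℂ) * Complex.exp (θ * Complex.I) := by fun_prop
    exact (e.symm.continuous.comp this).add continuous_const
  have hce : ∀ θ, e (c θ - p) = R * Complex.exp (θ * Complex.I) := fun θ => by simp [c]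
  refine not_exists_log_circle (G := fun θ => L (c θ)) (R := R) (by fun_prop) (fun θ => ?_) ?_
  · have hcC : c θ ∉ C := fun h => by
      have := hR (mem_image_of_mem _ h)
      simp only [hce] at this
      simp [Complex.norm_exp_ofReal_mul_I, abs_of_pos hRpos] at this
    rw [hL, ← hce]
    simp [F, hcC]
  · simp only [c]
    congr 4
    simp [Complex.exp_two_pi_mul_I]

/-- An arc does not separate the plane. -/
theorem not_isBounded_connectedComponentIn_compl_arc {α : ℝ → Plane} {c d : ℝ} (hcd : c ≤ d)
    (hα : ContinuousOn α (Icc c d)) (hinj : InjOn α (Icc c d)) {p : Plane}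
    (hp : p ∉ α '' Icc c d) :
    ¬ Bornology.IsBounded (connectedComponentIn (α '' Icc c d)ᶜ p) := by
  set e := Complex.equivRealProdCLM.symm
  have hcont : Continuous fun t : Icc c d => α t := hα.comp_continuous (by fun_prop) (fun t => t.2)
  have hemb : Topology.IsClosedEmbedding fun t : Icc c d => α t :=
    hcont.isClosedEmbedding fun s t h => Subtype.ext (hinj s.2 t.2 h)
  have hg : Continuous fun t : ℝ => e (α (projIcc c d hcd t) - p) :=
    e.continuous.comp ((hcont.comp continuous_projIcc).sub continuous_const)
  obtain ⟨L, hL⟩ := exists_continuous_log ⟨_, hg⟩ (fun t => by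
    have : α (projIcc c d hcd t) - p ≠ 0 := fun h =>
      hp ⟨_, (projIcc c d hcd t).2, sub_eq_zero.1 h⟩
    exact e.map_eq_zero_iff.not.2 this)
  obtain ⟨G, hG⟩ := (L.comp ⟨Subtype.val, continuous_subtype_val⟩ : C(Icc c d, ℂ)).exists_extension'
    hemb
  refine not_isBounded_connectedComponentIn_of_log (isCompact_Icc.image_of_continuousOn hα).isClosed
    hp G ?_
  rintro _ ⟨t, ht, rfl⟩
  have h1 : G (α t) = L t := congrFun hG ⟨t, ht⟩
  rw [h1, hL]
  simp [projIcc_of_mem hcd ht, e]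

theorem isOpen_inside {γ : ℝ → Plane} (hγ : IsClosed (range γ)) : IsOpen (Inside γ) := by
  rw [isOpen_iff_mem_nhds]
  rintro z ⟨hz, hzb⟩
  filter_upwards [hγ.isOpen_compl.connectedComponentIn.mem_nhds (mem_connectedComponentIn hz)]
    with y hy
  exact ⟨connectedComponentIn_subset _ _ hy, by rwa [← connectedComponentIn_eq hy]⟩

theorem isBounded_inside {γ : ℝ → Plane} (hγ : Bornology.IsBounded (range γ)) :
    Bornology.IsBounded (Inside γ) := by
  obtain ⟨R, hR⟩ := hγ.subset_closedBall 0
  refine (Metric.isBounded_closedBall (x := (0 : Plane)) (r := max R 0)).subset ?_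
  rintro z ⟨hz, hzb⟩
  by_contra hzR
  have hz0 : max R 0 < ‖z‖ := by simpa using hzR
  have hray : (fun t : ℝ => t • z) '' Ici 1 ⊆ connectedComponentIn (range γ)ᶜ z := by
    refine IsPreconnected.subset_connectedComponentIn
      (isPreconnected_Ici.image _ (by fun_prop)) ⟨1, by simp, by simp⟩ ?_
    rintro _ ⟨t, ht, rfl⟩ hmem
    have h1 := hR hmem
    rw [mem_closedBall_zero_iff, norm_smul, Real.norm_eq_abs,
      abs_of_nonneg (zero_le_one.trans ht)] at h1
    have h2 : 1 * ‖z‖ ≤ t * ‖z‖ := mul_le_mul_of_nonneg_right ht (norm_nonneg z)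
    linarith [le_max_left R 0]
  obtain ⟨M, hM⟩ := (hzb.subset hray).subset_closedBall 0
  have hzpos : 0 < ‖z‖ := (le_max_right R 0).trans_lt hz0
  have h3 := hM (mem_image_of_mem _ (le_max_left 1 ((|M| + 1) / ‖z‖) : _ ∈ Ici (1 : ℝ)))
  rw [mem_closedBall_zero_iff, norm_smul, Real.norm_eq_abs,
    abs_of_nonneg (zero_le_one.trans (le_max_left _ _))] at h3
  have h4 := mul_le_mul_of_nonneg_right (le_max_right 1 ((|M| + 1) / ‖z‖)) hzpos.le
  rw [div_mul_cancel₀ _ hzpos.ne'] at h4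
  linarith [le_abs_self M]

theorem injOn_Ico_of_periodic {X : Type*} {ψ : ℝ → X} (hp : Periodic ψ 1)
    (hs : InjOn ψ (Ico 0 1)) (t₀ : ℝ) : InjOn ψ (Ico t₀ (t₀ + 1)) := by
  intro x hx y hy hxy
  have hfract : ∀ t, ψ (Int.fract t) = ψ t := fun t => by
    rw [← Int.self_sub_floor]
    simpa only [mul_one] using hp.sub_int_mul_eq ⌊t⌋ (x := t)
  have h : Int.fract x = Int.fract y :=
    hs ⟨Int.fract_nonneg x, Int.fract_lt_one x⟩ ⟨Int.fract_nonneg y, Int.fract_lt_one y⟩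
      (by rw [hfract, hfract, hxy])
  obtain ⟨n, hn⟩ := Int.fract_eq_fract.1 h
  have h1 : (n : ℝ) < 1 := by linarith [hx.2, hy.1]
  have h2 : (-1 : ℝ) < n := by linarith [hx.1, hy.2]
  have h3 : n = 0 := by
    have : n < 1 := by exact_mod_cast h1
    have : -1 < n := by exact_mod_cast h2
    omega
  rw [h3] at hn
  simpa [sub_eq_zero] using hn

/-- A point of a Jordan curve `ψ` is never enclosed by a loop that runs in the closed region
bounded by `ψ`. -/
theorem notMem_inside_of_mem_range {ψ γ : ℝ → Plane} (hψc : Continuous ψ) (hψp : Periodic ψ 1)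
    (hψs : IsSimpleLoop ψ) (hγ : IsClosed (range γ)) (hsub : range γ ⊆ Inside ψ ∪ range ψ)
    {p : Plane} (hp : p ∈ range ψ) : p ∉ Inside γ := by
  rintro ⟨hpγ, hpb⟩
  set C := connectedComponentIn (range γ)ᶜ p with hC
  have hCo : IsOpen C := hγ.isOpen_compl.connectedComponentIn
  have hpC : p ∈ C := mem_connectedComponentIn hpγ
  have hψk : IsCompact (range ψ) := hψp.compact_of_continuous one_ne_zero hψc
  have hIo : IsOpen (Inside ψ) := isOpen_inside hψk.isClosed
  have hIb : Bornology.IsBounded (Inside ψ) := isBounded_inside hψk.isBounded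
  -- the exterior of `ψ` does not meet `C`
  have hCK : C ⊆ Inside ψ ∪ range ψ := by
    intro z hz
    by_contra hzK
    rw [mem_union, not_or] at hzK
    apply hzK.1
    refine ⟨hzK.2, hpb.subset ?_⟩
    rw [hC, connectedComponentIn_eq hz]
    refine isPreconnected_connectedComponentIn.subset_connectedComponentIn
      (mem_connectedComponentIn hzK.2) ?_
    intro y hy hyγ
    rcases hsub hyγ with hyI | hyψ
    · exact hzK.1 ⟨hzK.2, by rw [connectedComponentIn_eq hy]; exact hyI.2⟩
    · exact connectedComponentIn_subset _ _ hy hyψ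
  obtain ⟨t₀, rfl⟩ := hp
  obtain ⟨ε, hε, hεC⟩ := Metric.mem_nhds_iff.1 (hψc.continuousAt.preimage_mem_nhds
    (hCo.mem_nhds hpC))
  obtain ⟨δ, hδ, hδε, hδ1⟩ : ∃ δ > 0, δ < ε ∧ δ < 1 / 2 :=
    ⟨min ε (1 / 2) / 2, by positivity, by linarith [min_le_left ε (1 / 2)],
      by linarith [min_le_right ε (1 / 2)]⟩
  have hinj := injOn_Ico_of_periodic hψp hψs t₀
  have harc : Icc (t₀ + δ) (t₀ + 1 - δ) ⊆ Ico t₀ (t₀ + 1) := fun t ht =>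
    ⟨by linarith [ht.1], by linarith [ht.2]⟩
  set A := ψ '' Icc (t₀ + δ) (t₀ + 1 - δ) with hA
  have hpA : ψ t₀ ∉ A := by
    rintro ⟨t, ht, h⟩
    have := hinj (harc ht) ⟨le_rfl, by linarith⟩ h
    linarith [ht.1]
  have hψA : range ψ ⊆ A ∪ C := by
    rw [← hψp.image_Icc one_pos (t₀ - δ)]
    rintro _ ⟨t, ht, rfl⟩
    by_cases htδ : t ≤ t₀ + δ
    · refine Or.inr (hεC ?_)
      rw [Metric.mem_ball, Real.dist_eq, abs_lt]
      constructor <;> linarith [ht.1]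
    · exact Or.inl ⟨t, ⟨by linarith, by linarith [ht.2]⟩, rfl⟩
  refine not_isBounded_connectedComponentIn_compl_arc (α := ψ) (c := t₀ + δ) (d := t₀ + 1 - δ)
    (by linarith) hψc.continuousOn (hinj.mono harc) hpA ((hIb.union hpb).subset ?_)
  have hAc : IsClosed A := (isCompact_Icc.image hψc).isClosed
  refine isPreconnected_connectedComponentIn.subset_left_of_subset_union (hIo.union hCo)
    (v := (Inside ψ ∪ range ψ)ᶜ) ?_ ?_ ?_ ⟨ψ t₀, mem_connectedComponentIn hpA, Or.inr hpC⟩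
  · rw [isOpen_iff_mem_nhds]
    intro z hz
    rw [mem_compl_iff, mem_union, not_or] at hz
    filter_upwards [hψk.isClosed.isOpen_compl.connectedComponentIn.mem_nhds
      (mem_connectedComponentIn hz.2)] with y hy
    rintro (hyI | hyψ)
    · exact hz.1 ⟨hz.2, by rw [connectedComponentIn_eq hy]; exact hyI.2⟩
    · exact connectedComponentIn_subset _ _ hy hyψ
  · exact disjoint_compl_right.mono_left (union_subset subset_union_left hCK)
  · intro z hz
    by_cases hzK : z ∈ Inside ψ ∪ range ψ
    · rcases hzK with hzI | hzψ
      · exact Or.inl (Or.inl hzI)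
      · exact Or.inl (Or.inr ((hψA hzψ).resolve_left (connectedComponentIn_subset _ _ hz)))
    · exact Or.inr hzK

theorem exists_continuousLinearMap_eq_neg_one_eq_one {v w : Plane}
    (h : LinearIndependent ℝ ![v, w]) : ∃ L : Plane →L[ℝ] ℝ, L v = -1 ∧ L w = 1 := by
  rw [LinearIndependent.pair_iff] at h
  have hD : v.1 * w.2 - v.2 * w.1 ≠ 0 := by
    intro hD
    obtain ⟨hw1, hv1⟩ := h w.1 (-v.1) (by ext <;> simp <;> linarith)
    obtain ⟨hw2, hv2⟩ := h w.2 (-v.2) (by ext <;> simp <;> linarith)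
    have := h 1 0 (by ext <;> simp <;> linarith)
    exact one_ne_zero this.1
  obtain ⟨D, hDdef⟩ : ∃ D, D = v.1 * w.2 - v.2 * w.1 := ⟨_, rfl⟩
  rw [← hDdef] at hD
  refine ⟨((-w.2 - v.2) / D) • ContinuousLinearMap.fst ℝ ℝ ℝ +
    ((v.1 + w.1) / D) • ContinuousLinearMap.snd ℝ ℝ ℝ, ?_, ?_⟩ <;>
  · simp only [add_apply, smul_apply,
      ContinuousLinearMap.coe_fst', ContinuousLinearMap.coe_snd', smul_eq_mul]
    field_simp
    rw [hDdef]
    ring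

theorem eventually_pos_right_neg_left {φ : ℝ → ℝ} {φ' x : ℝ} (h : HasDerivAt φ φ' x)
    (hpos : 0 < φ') (hx : φ x = 0) : ∀ᶠ t in nhds x, (x < t → 0 < φ t) ∧ (t < x → φ t < 0) := by
  have hd : 0 < deriv φ x := by rwa [h.deriv]
  filter_upwards [eventually_nhdsWithin_sign_eq_of_deriv_pos hd hx] with t ht
  refine ⟨fun hlt => ?_, fun hlt => ?_⟩
  · rwa [sign_pos (sub_pos.2 hlt), sign_eq_one_iff] at ht
  · rwa [sign_neg (sub_neg.2 hlt), sign_eq_neg_one_iff] at ht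

theorem range_subLoop {f : ℝ → Plane} {a b : ℝ} (hab : a < b) (heq : f a = f b) :
    range (subLoop f a b) = f '' Icc a b := by
  have hba : 0 < b - a := sub_pos.2 hab
  apply subset_antisymm
  · rintro _ ⟨t, rfl⟩
    refine ⟨_, ⟨?_, ?_⟩, rfl⟩
    · nlinarith [Int.fract_nonneg t]
    · nlinarith [Int.fract_lt_one t]
  · rintro _ ⟨t, ht, rfl⟩
    rcases ht.2.eq_or_lt with rfl | htb
    · exact ⟨0, by simp [subLoop, heq]⟩
    · refine ⟨(t - a) / (b - a), ?_⟩
      have hfr : Int.fract ((t - a) / (b - a)) = (t - a) / (b - a) :=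
        Int.fract_eq_self.2 ⟨div_nonneg (sub_nonneg.2 ht.1) hba.le,
          (div_lt_one hba).2 (by linarith)⟩
      simp only [subLoop, hfr, mul_div_cancel₀ _ hba.ne', add_sub_cancel]

/-- If a curve crosses itself transversally at `f a = f b`, then points shortly before time `a` and
shortly after time `b` are joined by a segment that misses the loop `f|[a,b]`. -/
theorem exists_segment_disjoint_of_transversal {f : ℝ → Plane} {a b : ℝ} {v w : Plane}
    (hab : a < b) (hf : ContinuousOn f (Icc a b)) (heq : f a = f b)
    (hne : ∀ t ∈ Ioo a b, f t ≠ f a) (hv : HasDerivAt f v a) (hw : HasDerivAt f w b)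
    (hvw : LinearIndependent ℝ ![v, w]) {a' b' : ℝ} (ha' : a' < a) (hb' : b < b') :
    ∃ s ∈ Ioo a' a, ∃ t ∈ Ioo b b', Disjoint (segment ℝ (f s) (f t)) (f '' Icc a b) := by
  obtain ⟨L, hLv, hLw⟩ := exists_continuousLinearMap_eq_neg_one_eq_one hvw
  have hφ {x : ℝ} {u : Plane} (hu : HasDerivAt f u x) :
      HasDerivAt (fun t => L (f t - f a)) (L u) x :=
    L.hasFDerivAt.comp_hasDerivAt x (hu.sub_const (f a))
  have hA := eventually_pos_right_neg_left (hφ hv).neg (by simp [hLv]) (by simp)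
  have hB := eventually_pos_right_neg_left (hφ hw) (by simp [hLw]) (by simp [heq])
  obtain ⟨ε₁, hε₁, hA'⟩ := Metric.eventually_nhds_iff.1 hA
  obtain ⟨ε₂, hε₂, hB'⟩ := Metric.eventually_nhds_iff.1 hB
  have hK : IsClosed (f '' Icc (a + ε₁ / 2) (b - ε₂ / 2)) :=
    (isCompact_Icc.image_of_continuousOn
      (hf.mono (Icc_subset_Icc (by linarith) (by linarith)))).isClosed
  have hqK : f a ∉ f '' Icc (a + ε₁ / 2) (b - ε₂ / 2) := by
    rintro ⟨t, ht, h⟩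
    exact hne t ⟨by linarith [ht.1], by linarith [ht.2]⟩ h
  obtain ⟨r, hr, hrK⟩ := Metric.mem_nhds_iff.1 (hK.isOpen_compl.mem_nhds hqK)
  have hsEv : ∀ᶠ s in nhdsWithin a (Iio a), s ∈ Ioo a' a ∧ f s ∈ Metric.ball (f a) r ∧
      0 < L (f s - f a) := by
    filter_upwards [Ioo_mem_nhdsLT ha', nhdsWithin_le_nhds hA,
      nhdsWithin_le_nhds (hv.continuousAt.preimage_mem_nhds (Metric.ball_mem_nhds _ hr))]
      with s hs h1 h2
    exact ⟨hs, h2, by simpa using h1.2 hs.2⟩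
  have htEv : ∀ᶠ t in nhdsWithin b (Ioi b), t ∈ Ioo b b' ∧ f t ∈ Metric.ball (f a) r ∧
      0 < L (f t - f a) := by
    filter_upwards [Ioo_mem_nhdsGT hb', nhdsWithin_le_nhds hB,
      nhdsWithin_le_nhds (hw.continuousAt.preimage_mem_nhds (Metric.ball_mem_nhds _ hr))]
      with t ht h1 h2
    exact ⟨ht, heq ▸ h2, h1.1 ht.1⟩
  obtain ⟨s, hs, hsr, hsL⟩ := hsEv.exists
  obtain ⟨t, ht, htr, htL⟩ := htEv.exists
  refine ⟨s, hs, t, ht, ?_⟩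
  have hconv : Convex ℝ {z : Plane | 0 < L (z - f a)} := by
    simp only [map_sub, sub_pos]
    exact convex_halfSpace_gt L.isLinear _
  have hseg : segment ℝ (f s) (f t) ⊆ Metric.ball (f a) r ∩ {z | 0 < L (z - f a)} :=
    ((convex_ball _ _).inter hconv).segment_subset ⟨hsr, hsL⟩ ⟨htr, htL⟩
  rw [Set.disjoint_left]
  rintro z hz ⟨x, hx, rfl⟩
  obtain ⟨hzr, hzL⟩ := hseg hz
  by_cases hx1 : x < a + ε₁ / 2
  · rcases hx.1.eq_or_lt with rfl | hax
    · simp at hzL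
    · have := (hA' (by rw [Real.dist_eq, abs_lt]; constructor <;> linarith : dist x a < ε₁)).1 hax
      simp only [Pi.neg_apply, Left.neg_pos_iff] at this
      exact lt_asymm hzL this
  by_cases hx2 : b - ε₂ / 2 < x
  · rcases hx.2.eq_or_lt with rfl | hxb
    · simp [heq] at hzL
    · exact lt_asymm hzL
        ((hB' (by rw [Real.dist_eq, abs_lt]; constructor <;> linarith : dist x b < ε₂)).2 hxb)
  · exact hrK hzr ⟨x, ⟨not_lt.1 hx1, not_lt.1 hx2⟩, rfl⟩

/-- **Base case of Lemma 2.**  Let `ψ` be a simple 1-periodic loop, `D = Inside ψ`,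
`P ⊆ D` finite, `Ω = (D ∪ range ψ) \ P`.  Let `f` be a minimal generic curve in `Ω`
with exactly one double point, with preimages `a < b` in `(0,1)`, such that
`f 0 ∈ range ψ`, neither endpoint is the double point, and the loop `f|[a,b]` is
freely homotopic to `ψ` in `Ω`.  Then `f 1` lies outside the simple loop `f|[a,b]`. -/
theorem lemma2_base_case
    (ψ : ℝ → Plane) (hψc : Continuous ψ) (hψp : Periodic ψ 1)
    (hψs : IsSimpleLoop ψ)
    (P : Set Plane) (hPfin : P.Finite) (hPD : P ⊆ Inside ψ)
    (f : ℝ → Plane) (a b : ℝ)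
    (hmin : MinimalCurve ((Inside ψ ∪ range ψ) \ P) f)
    (ha : a ∈ Ioo (0:ℝ) 1) (hb : b ∈ Ioo (0:ℝ) 1) (hab : a < b) (heq : f a = f b)
    (honedbl : doublePointsCurve f = {f a})
    (h0 : f 0 ∈ range ψ)
    (hend0 : f 0 ≠ f a) (hend1 : f 1 ≠ f a)
    (hhom : FreelyHomotopicIn ((Inside ψ ∪ range ψ) \ P) (subLoop f a b) ψ) :
    f 1 ∉ Inside (subLoop f a b) := by
  obtain ⟨⟨hC1, hfS, -, -, htrans, htriple⟩, -⟩ := hmin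
  have haI : a ∈ Icc (0:ℝ) 1 := Ioo_subset_Icc_self ha
  have hbI : b ∈ Icc (0:ℝ) 1 := Ioo_subset_Icc_self hb
  have hsubI : Icc a b ⊆ Icc (0:ℝ) 1 := Icc_subset_Icc haI.1 hbI.2
  have hrange := range_subLoop hab heq
  have hderiv : ∀ x ∈ Ioo (0:ℝ) 1, HasDerivAt f (derivWithin f (Icc 0 1) x) x := fun x hx =>
    ((hC1.differentiableOn one_ne_zero x (Ioo_subset_Icc_self hx)).hasDerivWithinAt).hasDerivAt
      (Icc_mem_nhds hx.1 hx.2)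
  have hab_trans := (htrans a haI b hbI hab.ne heq
    (by rintro (⟨h, -⟩ | ⟨h, -⟩); exacts [ha.1.ne' h, ha.2.ne h])).2.2
  have hne : ∀ t ∈ Icc (0:ℝ) 1, t ≠ a → t ≠ b → f t ≠ f a := fun t ht hta htb h =>
    htriple t ht a haI b hbI hta hab.ne htb h heq
  have havoid : ∀ t ∈ Icc (0:ℝ) 1, t ∉ Icc a b → f t ∉ range (subLoop f a b) := by
    intro t ht htab hmem
    rw [hrange] at hmem
    obtain ⟨s, hs, hst⟩ := hmem
    have hs01 : s ∈ Ioo (0:ℝ) 1 := ⟨ha.1.trans_le hs.1, hs.2.trans_lt hb.2⟩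
    have hne_st : s ≠ t := fun h => htab (h ▸ hs)
    obtain ⟨-, ht01, -⟩ := htrans s (hsubI hs) t ht hne_st hst
      (by rintro (⟨h, -⟩ | ⟨h, -⟩); exacts [hs01.1.ne' h, hs01.2.ne h])
    have hdbl : f t ∈ doublePointsCurve f := ⟨s, hs01, t, ht01, hne_st, hst, rfl⟩
    rw [honedbl, mem_singleton_iff] at hdbl
    exact hne t ht (fun h => htab ⟨h.ge, h.trans_le hab.le⟩)
      (fun h => htab ⟨hab.le.trans_eq h.symm, h.le⟩) hdbl
  obtain ⟨s, hs, t, ht, hst⟩ := exists_segment_disjoint_of_transversal hab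
    (hC1.continuousOn.mono hsubI) heq
    (fun t ht => hne t (hsubI (Ioo_subset_Icc_self ht)) ht.1.ne' ht.2.ne)
    (hderiv a ha) (hderiv b hb) hab_trans ha.1 hb.2
  have hsI : Icc 0 s ⊆ Icc (0:ℝ) 1 := Icc_subset_Icc le_rfl (hs.2.le.trans haI.2)
  have htI : Icc t 1 ⊆ Icc (0:ℝ) 1 := Icc_subset_Icc (hbI.1.trans ht.1.le) le_rfl
  have hconn : IsPreconnected (f '' Icc 0 s ∪ segment ℝ (f s) (f t) ∪ f '' Icc t 1) := by
    refine IsPreconnected.union (f t) (Or.inr (right_mem_segment ℝ _ _))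
      (mem_image_of_mem f (left_mem_Icc.2 ht.2.le)) ?_
      (isPreconnected_Icc.image f (hC1.continuousOn.mono htI))
    exact IsPreconnected.union (f s) (mem_image_of_mem f (right_mem_Icc.2 hs.1.le))
      (left_mem_segment ℝ _ _) (isPreconnected_Icc.image f (hC1.continuousOn.mono hsI))
      (convex_segment _ _).isPreconnected
  have hcompl : f '' Icc 0 s ∪ segment ℝ (f s) (f t) ∪ f '' Icc t 1 ⊆
      (range (subLoop f a b))ᶜ := by
    rintro _ ((⟨x, hx, rfl⟩ | hz) | ⟨x, hx, rfl⟩)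
    · exact havoid x (hsI hx) fun h => (hx.2.trans_lt hs.2).not_ge h.1
    · rw [hrange]
      exact Set.disjoint_left.1 hst hz
    · exact havoid x (htI hx) fun h => (ht.1.trans_le hx.1).not_ge h.2
  have h0mem : f 0 ∈ f '' Icc 0 s ∪ segment ℝ (f s) (f t) ∪ f '' Icc t 1 :=
    Or.inl (Or.inl (mem_image_of_mem f (left_mem_Icc.2 hs.1.le)))
  have h1mem : f 1 ∈ f '' Icc 0 s ∪ segment ℝ (f s) (f t) ∪ f '' Icc t 1 :=
    Or.inr (mem_image_of_mem f (right_mem_Icc.2 ht.2.le))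
  have hclosed : IsClosed (range (subLoop f a b)) := by
    rw [hrange]
    exact (isCompact_Icc.image_of_continuousOn (hC1.continuousOn.mono hsubI)).isClosed
  have hsub : range (subLoop f a b) ⊆ Inside ψ ∪ range ψ := by
    rw [hrange]
    exact (image_mono hsubI).trans (hfS.trans sdiff_subset)
  rintro ⟨-, hbdd⟩
  refine notMem_inside_of_mem_range hψc hψp hψs hclosed hsub h0 ⟨hcompl h0mem, ?_⟩
  rwa [connectedComponentIn_eq (hconn.subset_connectedComponentIn h0mem hcompl h1mem)]
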